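/- Let L > 0, T > 0 and let u, v : ℝ × ℝ → ℝ be smooth functions, f : ℝ × ℝ → ℝ a function such that both u and v satisfy w_t + w_x + w_xxx = f on [0,L] × [0,T]. Assume u(x,0) = v(x,0) for all x ∈ [0,L], and u(0,t) = v(0,t), u_x(L,t) = v_x(L,t), u_xx(L,t) = v_xx(L,t) for all t ∈ [0,T]. Then u(x,t) = v(x,t) for all (x,t) ∈ [0,L] × [0,T]. -/

import Mathlib

open Set

lemma aux_dx (g : ℝ → ℝ → ℝ) (hg : ContDiff ℝ (⊤ : ℕ∞) (Function.uncurry g)) :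
    ∃ gx : ℝ → ℝ → ℝ, ContDiff ℝ (⊤ : ℕ∞) (Function.uncurry gx) ∧
      ∀ x t, HasDerivAt (fun y => g y t) (gx x t) x := by
  refine ⟨fun x t => fderiv ℝ (Function.uncurry g) (x, t) (1, 0), ?_, ?_⟩
  · have h : ContDiff ℝ (⊤ : ℕ∞) (fderiv ℝ (Function.uncurry g)) :=
      hg.fderiv_right (by simp)
    exact h.clm_apply contDiff_const
  · intro x t
    have h := (hg.differentiable (by simp) (x, t)).hasFDerivAt
    exact HasFDerivAt.comp_hasDerivAt (f := fun y : ℝ => (y, t)) x h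
      ((hasDerivAt_id x).prodMk (hasDerivAt_const x t))

lemma aux_dt (g : ℝ → ℝ → ℝ) (hg : ContDiff ℝ (⊤ : ℕ∞) (Function.uncurry g)) :
    ∃ gt : ℝ → ℝ → ℝ, ContDiff ℝ (⊤ : ℕ∞) (Function.uncurry gt) ∧
      ∀ x t, HasDerivAt (fun s => g x s) (gt x t) t := by
  refine ⟨fun x t => fderiv ℝ (Function.uncurry g) (x, t) (0, 1), ?_, ?_⟩
  · have h : ContDiff ℝ (⊤ : ℕ∞) (fderiv ℝ (Function.uncurry g)) :=
      hg.fderiv_right (by simp)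
    exact h.clm_apply contDiff_const
  · intro x t
    have h := (hg.differentiable (by simp) (x, t)).hasFDerivAt
    exact HasFDerivAt.comp_hasDerivAt (f := fun y : ℝ => (x, y)) t h
      ((hasDerivAt_const t x).prodMk (hasDerivAt_id t))

lemma aux_energy_deriv (L : ℝ) (g gt : ℝ → ℝ → ℝ)
    (hg : Continuous (Function.uncurry g)) (hgt : Continuous (Function.uncurry gt))
    (h : ∀ x t, HasDerivAt (fun s => g x s) (gt x t) t) (t : ℝ) :
    HasDerivAt (fun s => ∫ x in (0:ℝ)..L, g x s) (∫ x in (0:ℝ)..L, gt x t) t := by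
  obtain ⟨C, hC⟩ := (isCompact_uIcc (a := (0:ℝ)) (b := L)).prod
    (isCompact_closedBall t 1) |>.exists_bound_of_continuousOn hgt.continuousOn
  have hx : ∀ s, Continuous (fun x => g x s) := fun s =>
    hg.comp (continuous_id.prodMk continuous_const)
  have hx' : ∀ s, Continuous (fun x => gt x s) := fun s =>
    hgt.comp (continuous_id.prodMk continuous_const)
  refine (intervalIntegral.hasDerivAt_integral_of_dominated_loc_of_deriv_le
    (F := fun s x => g x s) (F' := fun s x => gt x s) (bound := fun _ => C)
    (s := Metric.closedBall t 1) (Metric.closedBall_mem_nhds t one_pos)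
    (Filter.Eventually.of_forall fun s => (hx s).aestronglyMeasurable)
    ((hx t).intervalIntegrable _ _) (hx' t).aestronglyMeasurable ?_
    intervalIntegrable_const ?_).2
  · exact Filter.Eventually.of_forall fun x hxm s hs => hC (x, s) ⟨uIoc_subset_uIcc hxm, hs⟩
  · exact Filter.Eventually.of_forall fun x _ s _ => h x s

theorem uniqueness_smooth_solutions_forced_linear_ibvp
    (L T : ℝ) (hL : 0 < L) (hT : 0 < T)
    (u v : ℝ → ℝ → ℝ) (f : ℝ → ℝ → ℝ)
    (hu : ContDiff ℝ (⊤ : ℕ∞) (Function.uncurry u))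
    (hv : ContDiff ℝ (⊤ : ℕ∞) (Function.uncurry v))
    (hequ : ∀ x ∈ Icc (0:ℝ) L, ∀ t ∈ Icc (0:ℝ) T,
      deriv (fun s => u x s) t + deriv (fun y => u y t) x
        + iteratedDeriv 3 (fun y => u y t) x = f x t)
    (heqv : ∀ x ∈ Icc (0:ℝ) L, ∀ t ∈ Icc (0:ℝ) T,
      deriv (fun s => v x s) t + deriv (fun y => v y t) x
        + iteratedDeriv 3 (fun y => v y t) x = f x t)
    (hinit : ∀ x ∈ Icc (0:ℝ) L, u x 0 = v x 0)
    (hbc : ∀ t ∈ Icc (0:ℝ) T,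
      u 0 t = v 0 t ∧ deriv (fun y => u y t) L = deriv (fun y => v y t) L
        ∧ iteratedDeriv 2 (fun y => u y t) L = iteratedDeriv 2 (fun y => v y t) L) :
    ∀ x ∈ Icc (0:ℝ) L, ∀ t ∈ Icc (0:ℝ) T, u x t = v x t := by
  obtain ⟨u1, hu1, du1⟩ := aux_dx u hu
  obtain ⟨u2, hu2, du2⟩ := aux_dx u1 hu1
  obtain ⟨u3, hu3, du3⟩ := aux_dx u2 hu2
  obtain ⟨ut, hut, dut⟩ := aux_dt u hu
  obtain ⟨v1, hv1, dv1⟩ := aux_dx v hv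
  obtain ⟨v2, hv2, dv2⟩ := aux_dx v1 hv1
  obtain ⟨v3, hv3, dv3⟩ := aux_dx v2 hv2
  obtain ⟨vt, hvt, dvt⟩ := aux_dt v hv
  have eu1 : ∀ t, deriv (fun y => u y t) = fun x => u1 x t :=
    fun t => funext fun x => (du1 x t).deriv
  have eu2 : ∀ t, deriv (fun y => u1 y t) = fun x => u2 x t :=
    fun t => funext fun x => (du2 x t).deriv
  have eu3 : ∀ t, deriv (fun y => u2 y t) = fun x => u3 x t :=
    fun t => funext fun x => (du3 x t).deriv
  have ev1 : ∀ t, deriv (fun y => v y t) = fun x => v1 x t :=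
    fun t => funext fun x => (dv1 x t).deriv
  have ev2 : ∀ t, deriv (fun y => v1 y t) = fun x => v2 x t :=
    fun t => funext fun x => (dv2 x t).deriv
  have ev3 : ∀ t, deriv (fun y => v2 y t) = fun x => v3 x t :=
    fun t => funext fun x => (dv3 x t).deriv
  have eut : ∀ x t, deriv (fun s => u x s) t = ut x t := fun x t => (dut x t).deriv
  have evt : ∀ x t, deriv (fun s => v x s) t = vt x t := fun x t => (dvt x t).deriv
  simp only [iteratedDeriv_succ', iteratedDeriv_zero, eu1, eu2, eu3, ev1, ev2, ev3, eut, evt]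
    at hequ heqv hbc
  have cw : Continuous (Function.uncurry fun x t => u x t - v x t) :=
    hu.continuous.sub hv.continuous
  have cwt : Continuous (Function.uncurry fun x t => ut x t - vt x t) :=
    hut.continuous.sub hvt.continuous
  have cw2 : Continuous (Function.uncurry fun x t => (u x t - v x t) ^ 2) := by
    have h : Continuous fun p : ℝ × ℝ => (u p.1 p.2 - v p.1 p.2) := cw
    exact h.fun_pow 2
  have cww : Continuous (Function.uncurry
      fun x t => 2 * (u x t - v x t) * (ut x t - vt x t)) := by
    have h : Continuous fun p : ℝ × ℝ => (u p.1 p.2 - v p.1 p.2) := cw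
    have h' : Continuous fun p : ℝ × ℝ => (ut p.1 p.2 - vt p.1 p.2) := cwt
    exact (continuous_const.fun_mul h).fun_mul h'
  have cx : ∀ g : ℝ → ℝ → ℝ, Continuous (Function.uncurry g) → ∀ t,
      Continuous (fun x => g x t) := fun g hg t =>
    hg.comp (continuous_id.prodMk continuous_const)
  have hE : ∀ t, HasDerivAt (fun s => ∫ x in (0:ℝ)..L, (u x s - v x s) ^ 2)
      (∫ x in (0:ℝ)..L, 2 * (u x t - v x t) * (ut x t - vt x t)) t := by
    intro t
    refine aux_energy_deriv L (fun x s => (u x s - v x s) ^ 2)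
      (fun x t => 2 * (u x t - v x t) * (ut x t - vt x t)) cw2
      cww (fun x t => ?_) t
    have := ((dut x t).fun_sub (dvt x t)).fun_pow 2
    simpa using this
  have hneg : ∀ t ∈ Icc (0:ℝ) T,
      (∫ x in (0:ℝ)..L, 2 * (u x t - v x t) * (ut x t - vt x t)) ≤ 0 := by
    intro t ht
    obtain ⟨b0, b1, b2⟩ := hbc t ht
    have hI := intervalIntegral.integral_eq_sub_of_hasDerivAt (a := 0) (b := L)
      (f := fun x => -((u x t - v x t) ^ 2 + 2 * ((u x t - v x t) * (u2 x t - v2 x t))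
        - (u1 x t - v1 x t) ^ 2))
      (f' := fun x => 2 * (u x t - v x t) * (ut x t - vt x t)) ?_ ?_
    · rw [hI]
      simp only [b0, b1, b2]
      nlinarith [sq_nonneg (u L t - v L t), sq_nonneg (u1 0 t - v1 0 t)]
    · intro x hx
      rw [uIcc_of_le hL.le] at hx
      have d0 := (du1 x t).sub (dv1 x t)
      have d1 := (du2 x t).sub (dv2 x t)
      have d2 := (du3 x t).sub (dv3 x t)
      have := (((d0.pow 2).add ((d0.mul d2).const_mul 2)).sub (d1.pow 2)).neg
      refine this.congr_deriv ?_
      have e : ut x t - vt x t = -(u1 x t - v1 x t) - (u3 x t - v3 x t) := by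
        linarith [hequ x hx t ht, heqv x hx t ht]
      simp only [e, Pi.sub_apply]
      push_cast
      ring
    · exact (cx _ cww t).intervalIntegrable _ _
  have hanti : AntitoneOn (fun s => ∫ x in (0:ℝ)..L, (u x s - v x s) ^ 2) (Icc 0 T) := by
    refine antitoneOn_of_deriv_nonpos (convex_Icc 0 T)
      (fun t _ => (hE t).continuousAt.continuousWithinAt)
      (fun t _ => (hE t).differentiableAt.differentiableWithinAt) ?_
    intro t ht
    rw [(hE t).deriv]
    exact hneg t (interior_subset ht)
  intro x hx t ht
  have h0 : (∫ x in (0:ℝ)..L, (u x 0 - v x 0) ^ 2) = 0 := by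
    rw [intervalIntegral.integral_congr (g := fun _ => (0:ℝ))]
    · simp
    · intro y hy
      rw [uIcc_of_le hL.le] at hy
      simp [hinit y hy]
  have h1 : (∫ x in (0:ℝ)..L, (u x t - v x t) ^ 2) ≤ 0 := by
    have := hanti ⟨le_rfl, hT.le⟩ ht ht.1
    simp only [h0] at this
    exact this
  by_contra hne
  have hpos : 0 < ∫ x in (0:ℝ)..L, (u x t - v x t) ^ 2 := by
    refine intervalIntegral.integral_pos hL (cx _ cw2 t).continuousOn
      (fun y _ => sq_nonneg _) ⟨x, hx, ?_⟩
    have := sub_ne_zero.mpr hne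
    positivity
  linarith
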